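/- Let a and b be non-lightlike vectors in the Lorentzian plane with the same causal character, the same orientation, and a/‖a‖_L ≠ b/‖b‖_L; write α = a/‖a‖_L and β = b/‖b‖_L. Let w be a vector with ‖w‖_L = 1 that has the same causal character and orientation as a. Then w is an angle bisector of a and b if and only if there exists φ ∈ ℝ such that w = A[φ]α and β = A[φ]w, where A[φ] is the 2×2 matrix with rows (cosh φ, sinh φ) and (sinh φ, cosh φ). -/

import Mathlib

noncomputable section

/-- The Lorentzian inner product on ℝ²: `⟪(a₁,a₂),(b₁,b₂)⟫_L = a₁b₁ − a₂b₂`. -/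
def lprod (v w : ℝ × ℝ) : ℝ := v.1 * w.1 - v.2 * w.2

/-- The Lorentzian magnitude `‖v‖_L = √|⟪v,v⟫_L|`. -/
def lmag (v : ℝ × ℝ) : ℝ := Real.sqrt |lprod v v|

/-- `w` is an angle bisector of `a` and `b` if
`⟪a,w⟫_L/√|⟪a,a⟫_L| = ⟪b,w⟫_L/√|⟪b,b⟫_L|`. -/
def IsAngleBisector (a b w : ℝ × ℝ) : Prop :=
  lprod a w / Real.sqrt |lprod a a| = lprod b w / Real.sqrt |lprod b b|

/-- `a` and `b` are non-lightlike of the same causal character: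
both spacelike or both timelike. -/
def SameCausal (a b : ℝ × ℝ) : Prop :=
  (0 < lprod a a ∧ 0 < lprod b b) ∨ (lprod a a < 0 ∧ lprod b b < 0)

/-- `a` and `b` are non-lightlike of the same causal character and orientation:
in the spacelike case the first coordinates have the same sign, in the timelike
case the second coordinates have the same sign. -/
def SameCausalOrient (a b : ℝ × ℝ) : Prop :=
  (0 < lprod a a ∧ 0 < lprod b b ∧ ((0 < a.1 ∧ 0 < b.1) ∨ (a.1 < 0 ∧ b.1 < 0))) ∨
  (lprod a a < 0 ∧ lprod b b < 0 ∧ ((0 < a.2 ∧ 0 < b.2) ∨ (a.2 < 0 ∧ b.2 < 0)))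

/-- The line through points `X` and `Y`: `{X + t(Y−X) : t ∈ ℝ}`. -/
def lineThrough (X Y : ℝ × ℝ) : Set (ℝ × ℝ) := {P | ∃ t : ℝ, P = X + t • (Y - X)}

/-- The Lorentzian rotation `A[φ] = [[cosh φ, sinh φ],[sinh φ, cosh φ]]`
acting on ℝ². -/
def lrot (φ : ℝ) (v : ℝ × ℝ) : ℝ × ℝ :=
  (Real.cosh φ * v.1 + Real.sinh φ * v.2, Real.sinh φ * v.1 + Real.cosh φ * v.2)

theorem lrot_add (s t : ℝ) (x : ℝ × ℝ) : lrot (s + t) x = lrot s (lrot t x) := by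
  ext <;> simp only [lrot, Real.cosh_add, Real.sinh_add] <;> ring

theorem lrot_zero (x : ℝ × ℝ) : lrot 0 x = x := by
  simp [lrot]

theorem lprod_comm (x y : ℝ × ℝ) : lprod x y = lprod y x := by
  simp only [lprod]; ring

theorem lprod_smul_left (c : ℝ) (x y : ℝ × ℝ) : lprod (c • x) y = c * lprod x y := by
  simp only [lprod, Prod.smul_fst, Prod.smul_snd, smul_eq_mul]; ring

theorem lprod_lrot_lrot (φ : ℝ) (x y : ℝ × ℝ) : lprod (lrot φ x) (lrot φ y) = lprod x y := by
  simp only [lprod, lrot]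
  linear_combination (x.1 * y.1 - x.2 * y.2) * Real.cosh_sq_sub_sinh_sq φ

theorem lprod_lrot_self (φ : ℝ) (x : ℝ × ℝ) : lprod x (lrot φ x) = Real.cosh φ * lprod x x := by
  simp only [lprod, lrot]; ring

theorem isAngleBisector_iff_lprod_normalize (a b w : ℝ × ℝ) :
    IsAngleBisector a b w ↔ lprod ((lmag a)⁻¹ • a) w = lprod ((lmag b)⁻¹ • b) w := by
  simp only [IsAngleBisector, lprod_smul_left, lmag, div_eq_inv_mul]

theorem abs_lprod_eq_one_of_lmag_eq_one {x : ℝ × ℝ} (h : lmag x = 1) : |lprod x x| = 1 :=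
  Real.sqrt_eq_one.mp h

theorem lmag_pos {x : ℝ × ℝ} (h : lprod x x ≠ 0) : 0 < lmag x :=
  Real.sqrt_pos.mpr (abs_pos.mpr h)

theorem abs_lprod_normalize {x : ℝ × ℝ} (h : lprod x x ≠ 0) :
    |lprod ((lmag x)⁻¹ • x) ((lmag x)⁻¹ • x)| = 1 := by
  have hm : lmag x ^ 2 = |lprod x x| := Real.sq_sqrt (abs_nonneg _)
  have hp := lmag_pos h
  rw [lprod_smul_left, lprod_comm, lprod_smul_left, abs_mul, abs_mul, ← hm,
    abs_of_pos (inv_pos.mpr hp)]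
  field_simp

namespace SameCausalOrient

variable {x y : ℝ × ℝ}

theorem symm (h : SameCausalOrient x y) : SameCausalOrient y x := by
  unfold SameCausalOrient at *; tauto

theorem lprod_left_ne_zero (h : SameCausalOrient x y) : lprod x x ≠ 0 := by
  rcases h with h | h
  exacts [h.1.ne', h.1.ne]

theorem smul_left (h : SameCausalOrient x y) {c : ℝ} (hc : 0 < c) :
    SameCausalOrient (c • x) y := by
  have hq : lprod (c • x) (c • x) = c ^ 2 * lprod x x := by
    rw [lprod_smul_left, lprod_comm, lprod_smul_left]; ring
  have hc2 : 0 < c ^ 2 := by positivity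
  simpa only [SameCausalOrient, hq, Prod.smul_fst, Prod.smul_snd, smul_eq_mul,
    mul_pos_iff_of_pos_left, mul_neg_iff, hc, hc2, hc.not_gt, hc2.not_gt, true_and,
    false_and, or_false] using h

/-- Rotations act transitively on each branch of the unit hyperbolas. -/
theorem exists_eq_lrot (h : SameCausalOrient x y) (hx : |lprod x x| = 1)
    (hy : |lprod y y| = 1) : ∃ φ : ℝ, y = lrot φ x := by
  obtain ⟨σ, hσ, hxσ, hyσ, hpos⟩ : ∃ σ : ℝ, σ ^ 2 = 1 ∧ lprod x x = σ ∧ lprod y y = σ ∧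
      0 ≤ σ * lprod x y := by
    rcases h with ⟨h₁, h₂, h₃⟩ | ⟨h₁, h₂, h₃⟩
    · rw [abs_of_pos h₁] at hx
      rw [abs_of_pos h₂] at hy
      refine ⟨1, by norm_num, hx, hy, ?_⟩
      simp only [lprod] at *
      have hs : 0 < x.1 * y.1 := mul_pos_iff.mpr h₃
      have : |x.2 * y.2| ≤ x.1 * y.1 :=
        abs_le_of_sq_le_sq (by nlinarith [sq_nonneg x.2, sq_nonneg y.2]) hs.le
      linarith [le_abs_self (x.2 * y.2)]
    · rw [abs_of_neg h₁] at hx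
      rw [abs_of_neg h₂] at hy
      refine ⟨-1, by norm_num, by linarith, by linarith, ?_⟩
      simp only [lprod] at *
      have hs : 0 < x.2 * y.2 := mul_pos_iff.mpr h₃
      have : |x.1 * y.1| ≤ x.2 * y.2 :=
        abs_le_of_sq_le_sq (by nlinarith [sq_nonneg x.1, sq_nonneg y.1]) hs.le
      linarith [le_abs_self (x.1 * y.1)]
  simp only [lprod] at hxσ hyσ hpos
  have hsinh := Real.sinh_arsinh (σ * (x.1 * y.2 - x.2 * y.1))
  set φ := Real.arsinh (σ * (x.1 * y.2 - x.2 * y.1))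
  have hcosh : Real.cosh φ = σ * (x.1 * y.1 - x.2 * y.2) := by
    refine (sq_eq_sq₀ (Real.cosh_pos φ).le hpos).mp ?_
    rw [Real.cosh_sq, hsinh]
    have hmul : (x.1 * x.1 - x.2 * x.2) * (y.1 * y.1 - y.2 * y.2) = 1 := by
      rw [hxσ, hyσ, ← sq, hσ]
    linear_combination (-σ ^ 2) * hmul - hσ
  refine ⟨φ, Prod.ext ?_ ?_⟩
  · simp only [lrot, hcosh, hsinh]
    linear_combination (-σ * y.1) * hxσ - y.1 * hσ
  · simp only [lrot, hcosh, hsinh]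
    linear_combination (-σ * y.2) * hxσ - y.2 * hσ

end SameCausalOrient

/-- for non-lightlike `a`, `b` of the same causal character and
orientation with distinct unit vectors `α = a/‖a‖_L`, `β = b/‖b‖_L`, a unit
vector `w` of the same causal character and orientation as `a` is an angle
bisector of `a` and `b` iff there is `φ` with `w = A[φ]α` and `β = A[φ]w`. -/
theorem isAngleBisector_iff_rotation (a b w : ℝ × ℝ)
    (hab : SameCausalOrient a b)
    (hne : (lmag a)⁻¹ • a ≠ (lmag b)⁻¹ • b)
    (hw1 : lmag w = 1) (hwa : SameCausalOrient a w) :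
    IsAngleBisector a b w ↔
      ∃ φ : ℝ, w = lrot φ ((lmag a)⁻¹ • a) ∧ (lmag b)⁻¹ • b = lrot φ w := by
  have ha := hab.lprod_left_ne_zero
  have hb := hab.symm.lprod_left_ne_zero
  have hia := inv_pos.mpr (lmag_pos ha)
  have hib := inv_pos.mpr (lmag_pos hb)
  have hα := abs_lprod_normalize ha
  have hβ := abs_lprod_normalize hb
  obtain ⟨s, hs⟩ := (hwa.smul_left hia).exists_eq_lrot hα (abs_lprod_eq_one_of_lmag_eq_one hw1)
  obtain ⟨r, hr⟩ := ((hab.smul_left hia).symm.smul_left hib).symm.exists_eq_lrot hα hβ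
  rw [isAngleBisector_iff_lprod_normalize]
  generalize (lmag a)⁻¹ • a = α at *
  generalize (lmag b)⁻¹ • b = β at *
  have hα0 : lprod α α ≠ 0 := abs_pos.mp (hα ▸ one_pos)
  constructor
  · intro h
    have hβw : β = lrot (r - s) w := by rw [hr, hs, ← lrot_add, sub_add_cancel]
    have hww : lprod w w = lprod α α := by rw [hs, lprod_lrot_lrot]
    have hcosh : Real.cosh s = Real.cosh (r - s) := by
      rw [lprod_comm β, hβw, lprod_lrot_self, hww, hs, lprod_lrot_self] at h
      exact mul_right_cancel₀ hα0 h
    have hrs : r - s = s := by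
      rcases abs_eq_abs.mp (le_antisymm (Real.cosh_le_cosh.mp hcosh.le)
          (Real.cosh_le_cosh.mp hcosh.ge)) with h' | h'
      · exact h'.symm
      · have : r = 0 := by linarith
        exact absurd (by rw [hr, this, lrot_zero]) hne
    exact ⟨s, hs, hrs ▸ hβw⟩
  · rintro ⟨φ, hw, hβw⟩
    calc lprod α w = lprod (lrot φ α) (lrot φ w) := (lprod_lrot_lrot φ α w).symm
      _ = lprod β w := by rw [← hw, ← hβw, lprod_comm]
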